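/- Suppose E is a graph satisfying Condition (L). If F is a finite subset of E* \ E⁰ (finite paths of positive length) and v ∈ E⁰, then there exists a path α ∈ E* with s(α) = v such that α* μ α = 0 in L_R(E) for every μ ∈ F. -/

import Mathlib

set_option maxHeartbeats 1000000
set_option synthInstance.maxHeartbeats 400000

noncomputable section

/-- A directed graph `E = (E⁰, E¹, r, s)` with countable vertex and edge sets,
together with range and source maps. -/
structure LPAGraph : Type 1 where
  V : Type
  E : Type
  countV : Countable V
  countE : Countable E
  src : E → V
  rng : E → V

namespace LPAGraph

/-- Generators of the Leavitt path algebra: vertices, real edges, and ghost edges. -/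
inductive LGen (G : LPAGraph) : Type
  | vert : G.V → LGen G
  | edge : G.E → LGen G
  | ghost : G.E → LGen G

/-- `IsPathFrom G u es w` : the list of edges `es` is a path from `u` to `w`
(paths of length zero are vertices). -/
inductive IsPathFrom (G : LPAGraph) : G.V → List G.E → G.V → Prop
  | nil (v : G.V) : IsPathFrom G v [] v
  | cons {u w : G.V} (e : G.E) {es : List G.E} (h : G.src e = u)
      (ht : IsPathFrom G (G.rng e) es w) : IsPathFrom G u (e :: es) w

/-- A vertex is regular if it emits at least one and only finitely many edges. -/
def Regular (G : LPAGraph) (v : G.V) : Prop :=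
  {e : G.E | G.src e = v}.Finite ∧ {e : G.E | G.src e = v}.Nonempty

/-- A graph is row-finite if every vertex emits only finitely many edges. -/
def RowFinite (G : LPAGraph) : Prop := ∀ v : G.V, {e : G.E | G.src e = v}.Finite

/-- A subset `H` of vertices is hereditary if `s(e) ∈ H` implies `r(e) ∈ H`. -/
def Hereditary (G : LPAGraph) (H : Set G.V) : Prop :=
  ∀ e : G.E, G.src e ∈ H → G.rng e ∈ H

/-- A subset `H` of vertices is saturated if every regular vertex, all of whose emitted
edges have range in `H`, belongs to `H`. -/
def Saturated (G : LPAGraph) (H : Set G.V) : Prop :=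
  ∀ v : G.V, G.Regular v → (∀ e : G.E, G.src e = v → G.rng e ∈ H) → v ∈ H

/-- The saturation of a set of vertices: the smallest saturated hereditary subset
containing it. -/
def saturation (G : LPAGraph) (X : Set G.V) : Set G.V :=
  ⋂₀ {H : Set G.V | G.Hereditary H ∧ G.Saturated H ∧ X ⊆ H}

/-- `HasExit G es` : the path `es` has an exit, i.e. there is an edge `f` with
`s(f) = s(eᵢ)` and `f ≠ eᵢ` for some `i`. -/
def HasExit (G : LPAGraph) (es : List G.E) : Prop :=
  ∃ (f : G.E) (i : Fin es.length), G.src f = G.src (es.get i) ∧ f ≠ es.get i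

/-- Condition (L): every cycle has an exit. -/
def CondL (G : LPAGraph) : Prop :=
  ∀ (v : G.V) (es : List G.E), es ≠ [] → IsPathFrom G v es v → G.HasExit es

/-- A closed path based at `v`. -/
def IsClosedPathAt (G : LPAGraph) (v : G.V) (es : List G.E) : Prop :=
  es ≠ [] ∧ IsPathFrom G v es v

/-- A simple closed path based at `v` : a closed path `e₁ … eₙ` based at `v` with
`s(eᵢ) ≠ v` for `i = 2, …, n`. -/
def IsSimpleClosedPathAt (G : LPAGraph) (v : G.V) (es : List G.E) : Prop :=
  G.IsClosedPathAt v es ∧ ∀ i : Fin es.length, i.1 ≠ 0 → G.src (es.get i) ≠ v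

/-- Condition (K): every vertex is the base of no closed path or of at least two
distinct simple closed paths. -/
def CondK (G : LPAGraph) : Prop :=
  ∀ v : G.V, (¬ ∃ es : List G.E, G.IsClosedPathAt v es) ∨
    (∃ es₁ es₂ : List G.E, G.IsSimpleClosedPathAt v es₁ ∧ G.IsSimpleClosedPathAt v es₂ ∧
      es₁ ≠ es₂)

variable (R : Type) [CommRing R] (G : LPAGraph)

open FreeAlgebra in
/-- The defining relations of the Leavitt path algebra (the relations of a
Leavitt `E`-family). -/
inductive LeavittRel : FreeAlgebra R (LGen G) → FreeAlgebra R (LGen G) → Prop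
  | vert_mul_self (v : G.V) :
      LeavittRel (ι R (LGen.vert v) * ι R (LGen.vert v)) (ι R (LGen.vert v))
  | vert_mul_vert (v w : G.V) (hvw : v ≠ w) :
      LeavittRel (ι R (LGen.vert v) * ι R (LGen.vert w)) 0
  | src_mul_edge (e : G.E) :
      LeavittRel (ι R (LGen.vert (G.src e)) * ι R (LGen.edge e)) (ι R (LGen.edge e))
  | edge_mul_rng (e : G.E) :
      LeavittRel (ι R (LGen.edge e) * ι R (LGen.vert (G.rng e))) (ι R (LGen.edge e))
  | rng_mul_ghost (e : G.E) :
      LeavittRel (ι R (LGen.vert (G.rng e)) * ι R (LGen.ghost e)) (ι R (LGen.ghost e))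
  | ghost_mul_src (e : G.E) :
      LeavittRel (ι R (LGen.ghost e) * ι R (LGen.vert (G.src e))) (ι R (LGen.ghost e))
  | ghost_mul_self (e : G.E) :
      LeavittRel (ι R (LGen.ghost e) * ι R (LGen.edge e)) (ι R (LGen.vert (G.rng e)))
  | ghost_mul_edge (e f : G.E) (hef : e ≠ f) :
      LeavittRel (ι R (LGen.ghost e) * ι R (LGen.edge f)) 0
  | ck (v : G.V) (s : Finset G.E) (hs : ∀ e : G.E, e ∈ s ↔ G.src e = v) (hne : s.Nonempty) :
      LeavittRel (ι R (LGen.vert v)) (∑ e ∈ s, ι R (LGen.edge e) * ι R (LGen.ghost e))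

/-- The ambient unital algebra: the universal unital `R`-algebra on the Leavitt relations. -/
abbrev Ambient : Type := RingQuot (LeavittRel R G)

/-- The images of the generators in the ambient algebra. -/
def ugen (x : LGen G) : Ambient R G :=
  RingQuot.mkAlgHom R (LeavittRel R G) (FreeAlgebra.ι R x)

/-- The Leavitt path algebra `L_R(E)`, realized as the non-unital subalgebra of the ambient
algebra generated by the Leavitt `E`-family (equivalently, the span of words in the
generators). -/
def LeavittSubalgebra : NonUnitalSubalgebra R (Ambient R G) :=
  NonUnitalAlgebra.adjoin R (Set.range (ugen R G))

/-- The Leavitt path algebra `L_R(E)` as a type; it is a non-unital `R`-algebra. -/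
abbrev LeavittPathAlgebra : Type := ↥(LeavittSubalgebra R G)

theorem ugen_mem (x : LGen G) : ugen R G x ∈ LeavittSubalgebra R G :=
  NonUnitalAlgebra.subset_adjoin R (Set.mem_range_self x)

/-- The vertex idempotent `v ∈ L_R(E)`. -/
def vertexElem (v : G.V) : LeavittPathAlgebra R G :=
  ⟨ugen R G (LGen.vert v), ugen_mem R G _⟩

/-- The real edge `e ∈ L_R(E)`. -/
def edgeElem (e : G.E) : LeavittPathAlgebra R G :=
  ⟨ugen R G (LGen.edge e), ugen_mem R G _⟩

/-- The ghost edge `e* ∈ L_R(E)`. -/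
def ghostElem (e : G.E) : LeavittPathAlgebra R G :=
  ⟨ugen R G (LGen.ghost e), ugen_mem R G _⟩

/-- The element `α = e₁ ⋯ eₙ` of the ambient algebra corresponding to a path; a path of
length zero starting at `u` is the vertex `u`. -/
def uPath (u : G.V) (es : List G.E) : Ambient R G :=
  ugen R G (LGen.vert u) * (es.map fun e => ugen R G (LGen.edge e)).prod

/-- The element `α* = eₙ* ⋯ e₁*` of the ambient algebra corresponding to a ghost path. -/
def uGhostPath (u : G.V) (es : List G.E) : Ambient R G :=
  ((es.map fun e => ugen R G (LGen.ghost e)).reverse).prod * ugen R G (LGen.vert u)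

private theorem list_prod_mem_aux (f : G.E → Ambient R G)
    (hf : ∀ e, f e ∈ LeavittSubalgebra R G) :
    ∀ es : List G.E, es ≠ [] → (es.map f).prod ∈ LeavittSubalgebra R G
  | [], h => absurd rfl h
  | [e], _ => by simpa using hf e
  | e :: e' :: t, _ => by
      rw [List.map_cons, List.prod_cons]
      exact mul_mem (hf e) (list_prod_mem_aux f hf (e' :: t) (by simp))

theorem uPath_mem (u : G.V) (es : List G.E) : uPath R G u es ∈ LeavittSubalgebra R G := by
  cases es with
  | nil => simpa [uPath] using ugen_mem R G (LGen.vert u)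
  | cons e t =>
      exact mul_mem (ugen_mem R G (LGen.vert u))
        (list_prod_mem_aux R G _ (fun e => ugen_mem R G (LGen.edge e)) (e :: t) (by simp))

theorem uGhostPath_mem (u : G.V) (es : List G.E) :
    uGhostPath R G u es ∈ LeavittSubalgebra R G := by
  cases es with
  | nil => simpa [uGhostPath] using ugen_mem R G (LGen.vert u)
  | cons e t =>
      rw [uGhostPath, ← List.map_reverse]
      exact mul_mem
        (list_prod_mem_aux R G _ (fun e => ugen_mem R G (LGen.ghost e)) ((e :: t).reverse)
          (by simp))
        (ugen_mem R G (LGen.vert u))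

/-- The element of `L_R(E)` corresponding to the path `α` with source `u` and edge list
`es` (for `es = []` this is the vertex `u`). -/
def pathElem (u : G.V) (es : List G.E) : LeavittPathAlgebra R G :=
  ⟨uPath R G u es, uPath_mem R G u es⟩

/-- The element of `L_R(E)` corresponding to the ghost path `α*` where `α` has source `u`
and edge list `es` (for `es = []` this is the vertex `u`). -/
def ghostPathElem (u : G.V) (es : List G.E) : LeavittPathAlgebra R G :=
  ⟨uGhostPath R G u es, uGhostPath_mem R G u es⟩

/-- The set of monomials `α β*` where `α, β` are paths with `r(α) = r(β)`. -/
def monomialSet : Set (LeavittPathAlgebra R G) :=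
  {x | ∃ (u : G.V) (es : List G.E) (u' : G.V) (es' : List G.E) (w : G.V),
    IsPathFrom G u es w ∧ IsPathFrom G u' es' w ∧
    x = pathElem R G u es * ghostPathElem R G u' es'}

/-- The degree-`k` homogeneous component `L_R(E)ₖ` of the canonical `ℤ`-grading:
the `R`-span of the monomials `α β*` with `|α| - |β| = k`. -/
def component (k : ℤ) : Submodule R (LeavittPathAlgebra R G) :=
  Submodule.span R
    {x | ∃ (u : G.V) (es : List G.E) (u' : G.V) (es' : List G.E) (w : G.V),
      IsPathFrom G u es w ∧ IsPathFrom G u' es' w ∧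
      (es.length : ℤ) - (es'.length : ℤ) = k ∧
      x = pathElem R G u es * ghostPathElem R G u' es'}

/-- An ideal `I` of `L_R(E)` is basic if `r • v ∈ I` with `r ∈ R \ {0}` and `v` a vertex
implies `v ∈ I`. -/
def IsBasicIdeal (I : TwoSidedIdeal (LeavittPathAlgebra R G)) : Prop :=
  ∀ (r : R) (v : G.V), r ≠ 0 → r • vertexElem R G v ∈ I → vertexElem R G v ∈ I

/-- An ideal `I` of the `ℤ`-graded ring `L_R(E)` is graded if `I = ⊕ₖ (I ∩ L_R(E)ₖ)`,
i.e. every element of `I` is a finite sum of homogeneous elements of `I`. -/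
def IsGradedIdeal (I : TwoSidedIdeal (LeavittPathAlgebra R G)) : Prop :=
  ∀ x ∈ I, ∃ (n : ℕ) (c : Fin n → LeavittPathAlgebra R G),
    (∀ i, c i ∈ I ∧ ∃ k : ℤ, c i ∈ component R G k) ∧ x = ∑ i, c i

/-- The two-sided ideal of `L_R(E)` generated by the vertices in a set `H` of vertices. -/
def idealOfSet (H : Set G.V) : TwoSidedIdeal (LeavittPathAlgebra R G) :=
  TwoSidedIdeal.span {x | ∃ v ∈ H, x = vertexElem R G v}

/-- `x ∈ L_R(E)` is a polynomial in only real edges if it is an `R`-linear combination of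
(real) paths. -/
def IsRealPoly (x : LeavittPathAlgebra R G) : Prop :=
  x ∈ Submodule.span R
    {y | ∃ (u : G.V) (es : List G.E) (w : G.V), IsPathFrom G u es w ∧ y = pathElem R G u es}

end LPAGraph

namespace LPAGraph

section Helpers

theorem IsPathFrom.app {G : LPAGraph} {u w x : G.V} {a b : List G.E}
    (ha : IsPathFrom G u a w) (hb : IsPathFrom G w b x) : IsPathFrom G u (a ++ b) x := by
  induction ha with
  | nil v => simpa using hb
  | cons e h ht ih => exact IsPathFrom.cons e h (ih hb)

theorem IsPathFrom.split {G : LPAGraph} {x : G.V} {b : List G.E} : ∀ {a : List G.E} {u : G.V},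
    IsPathFrom G u (a ++ b) x → ∃ w, IsPathFrom G u a w ∧ IsPathFrom G w b x
  | [], u, h => ⟨u, IsPathFrom.nil u, h⟩
  | e :: a, u, h => by
      cases h with
      | cons _ h ht =>
        obtain ⟨w, h1, h2⟩ := IsPathFrom.split ht
        exact ⟨w, IsPathFrom.cons e h h1, h2⟩

theorem IsPathFrom.rep {G : LPAGraph} {v : G.V} {m : List G.E} (hm : IsPathFrom G v m v) (k : ℕ) :
    IsPathFrom G v (List.replicate k m).flatten v := by
  induction k with
  | zero => simpa using IsPathFrom.nil v
  | succ k ih => simpa [List.replicate_succ] using hm.app ih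

theorem prefix_rep {X : Type} {m a : List X} (h : a <+: m ++ a) (k : ℕ) :
    a <+: (List.replicate k m).flatten ++ a := by
  induction k with
  | zero => simp
  | succ k ih =>
    rw [List.replicate_succ, List.flatten_cons, List.append_assoc]
    exact h.trans ((List.prefix_append_right_inj m).2 ih)

theorem rep_comm {X : Type} (m : List X) (k : ℕ) :
    m ++ (List.replicate k m).flatten = (List.replicate k m).flatten ++ m := by
  induction k with
  | zero => simp
  | succ k ih => rw [List.replicate_succ, List.flatten_cons, List.append_assoc, ← ih]

variable (R : Type) [CommRing R] (G : LPAGraph)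

theorem rel_eq {a b : FreeAlgebra R (LGen G)} (h : LeavittRel R G a b) :
    RingQuot.mkAlgHom R (LeavittRel R G) a = RingQuot.mkAlgHom R (LeavittRel R G) b :=
  RingQuot.mkAlgHom_rel R h

theorem u_vv (v : G.V) : ugen R G (.vert v) * ugen R G (.vert v) = ugen R G (.vert v) := by
  simpa [ugen] using rel_eq R G (LeavittRel.vert_mul_self v)

theorem u_vw {v w : G.V} (h : v ≠ w) : ugen R G (.vert v) * ugen R G (.vert w) = 0 := by
  simpa [ugen] using rel_eq R G (LeavittRel.vert_mul_vert v w h)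

theorem u_se (e : G.E) : ugen R G (.vert (G.src e)) * ugen R G (.edge e) = ugen R G (.edge e) := by
  simpa [ugen] using rel_eq R G (LeavittRel.src_mul_edge e)

theorem u_er (e : G.E) : ugen R G (.edge e) * ugen R G (.vert (G.rng e)) = ugen R G (.edge e) := by
  simpa [ugen] using rel_eq R G (LeavittRel.edge_mul_rng e)

theorem u_ge (e : G.E) :
    ugen R G (.ghost e) * ugen R G (.edge e) = ugen R G (.vert (G.rng e)) := by
  simpa [ugen] using rel_eq R G (LeavittRel.ghost_mul_self e)

theorem u_gf {e f : G.E} (h : e ≠ f) : ugen R G (.ghost e) * ugen R G (.edge f) = 0 := by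
  simpa [ugen] using rel_eq R G (LeavittRel.ghost_mul_edge e f h)

/-- A ghost path times a real path that does not extend it vanishes. -/
theorem ghost_path_zero : ∀ (a d : List G.E) (v : G.V), a.length ≤ d.length → ¬ a <+: d →
    ((a.map fun e => ugen R G (LGen.ghost e)).reverse).prod * ugen R G (.vert v) *
      (d.map fun e => ugen R G (LGen.edge e)).prod = 0
  | [], d, v, _, h => absurd ⟨d, rfl⟩ h
  | x :: a, [], v, hl, _ => by simp at hl
  | x :: a, y :: d, v, hl, h => by
      simp only [List.map_cons, List.reverse_cons, List.prod_append, List.prod_cons,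
        List.prod_nil, mul_one]
      by_cases hv : v = G.src y
      · subst hv
        by_cases hxy : x = y
        · subst hxy
          have ih := ghost_path_zero a d (G.rng x) (by simpa using hl)
            (fun h' => h (by simpa using h'))
          rw [← u_ge] at ih
          rw [mul_assoc, ← mul_assoc (ugen R G (.vert _)), u_se]
          simpa only [mul_assoc] using ih
        · rw [mul_assoc, ← mul_assoc (ugen R G (.vert _)), u_se, mul_assoc, ← mul_assoc
            (ugen R G (.ghost x)), u_gf R G hxy]
          simp
      · rw [mul_assoc, ← mul_assoc (ugen R G (.vert _)), ← u_se R G y,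
          ← mul_assoc (ugen R G (.vert v)), u_vw R G hv]
        simp

theorem path_end {u w : G.V} {m : List G.E} (h : IsPathFrom G u m w) (hne : m ≠ []) :
    (m.map fun e => ugen R G (LGen.edge e)).prod * ugen R G (.vert w) =
      (m.map fun e => ugen R G (LGen.edge e)).prod := by
  induction h with
  | nil v => exact absurd rfl hne
  | cons e h ht ih =>
    simp only [List.map_cons, List.prod_cons]
    cases ht with
    | nil => simpa using u_er R G e
    | cons f h' ht' => rw [mul_assoc, ih (by simp)]

theorem kill_ext {v u : G.V} {a m : List G.E} (b : List G.E)
    (h : uGhostPath R G v a * uPath R G u m * uPath R G v a = 0) :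
    uGhostPath R G v (a ++ b) * uPath R G u m * uPath R G v (a ++ b) = 0 := by
  have h1 : uGhostPath R G v (a ++ b) =
      ((b.map fun e => ugen R G (LGen.ghost e)).reverse).prod * uGhostPath R G v a := by
    simp [uGhostPath, mul_assoc]
  have h2 : uPath R G v (a ++ b) =
      uPath R G v a * (b.map fun e => ugen R G (LGen.edge e)).prod := by
    simp [uPath, mul_assoc]
  rw [h1, h2]
  generalize ((b.map fun e => ugen R G (LGen.ghost e)).reverse).prod = p
  generalize (b.map fun e => ugen R G (LGen.edge e)).prod = q
  calc p * uGhostPath R G v a * uPath R G u m * (uPath R G v a * q)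
      = p * (uGhostPath R G v a * uPath R G u m * uPath R G v a) * q := by
        simp only [mul_assoc]
    _ = 0 := by rw [h]; simp

theorem kill_closed {v : G.V} {a m : List G.E} (hm : IsPathFrom G v m v) (hne : m ≠ [])
    (h : ¬ a <+: m ++ a) :
    uGhostPath R G v a * uPath R G v m * uPath R G v a = 0 := by
  have h0 := ghost_path_zero R G a (m ++ a) v (by simp) h
  rw [List.map_append, List.prod_append] at h0
  unfold uGhostPath uPath
  have h1 := path_end R G hm hne
  generalize ((a.map fun e => ugen R G (LGen.ghost e)).reverse).prod = p at *
  generalize (a.map fun e => ugen R G (LGen.edge e)).prod = q at *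
  generalize (m.map fun e => ugen R G (LGen.edge e)).prod = r at *
  have h2 := u_vv R G v
  generalize ugen R G (.vert v) = x at *
  calc p * x * (x * r) * (x * q) = p * (x * x) * ((r * x) * q) := by simp only [mul_assoc]
    _ = 0 := by rw [h1, h2, h0]

theorem kill_open {v u w : G.V} {a m : List G.E} (hm : IsPathFrom G u m w) (hne : m ≠ [])
    (h : ¬ (v = u ∧ w = v)) :
    uGhostPath R G v a * uPath R G u m * uPath R G v a = 0 := by
  unfold uGhostPath uPath
  have h1 := path_end R G hm hne
  generalize ((a.map fun e => ugen R G (LGen.ghost e)).reverse).prod = p at *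
  generalize (a.map fun e => ugen R G (LGen.edge e)).prod = q at *
  generalize (m.map fun e => ugen R G (LGen.edge e)).prod = r at *
  by_cases hvu : v = u
  · have hwv : w ≠ v := fun h' => h ⟨hvu, h'⟩
    have h2 := u_vw R G hwv
    calc p * ugen R G (.vert v) * (ugen R G (.vert u) * r) * (ugen R G (.vert v) * q)
        = p * ugen R G (.vert v) * (ugen R G (.vert u) * (r * ugen R G (.vert w)))
            * (ugen R G (.vert v) * q) := by rw [h1]
      _ = p * ugen R G (.vert v) * (ugen R G (.vert u) * r) *
            (ugen R G (.vert w) * ugen R G (.vert v)) * q := by simp only [mul_assoc]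
      _ = 0 := by rw [h2]; simp
  · have h2 := u_vw R G hvu
    calc p * ugen R G (.vert v) * (ugen R G (.vert u) * r) * (ugen R G (.vert v) * q)
        = p * (ugen R G (.vert v) * ugen R G (.vert u)) * (r * (ugen R G (.vert v) * q)) := by
          simp only [mul_assoc]
      _ = 0 := by rw [h2]; simp

theorem exists_ext (hL : G.CondL) {v w : G.V} {a m : List G.E} (ha : IsPathFrom G v a w)
    (hm : IsPathFrom G v m v) (hne : m ≠ []) :
    ∃ (b : List G.E) (x : G.V), IsPathFrom G v (a ++ b) x ∧ ¬ (a ++ b) <+: m ++ (a ++ b) := by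
  by_cases h : a <+: m ++ a
  swap
  · exact ⟨[], w, by simpa using ha, by simpa using h⟩
  obtain ⟨f, i, hf, hfi⟩ := hL v m hne hm
  have hlen : 1 ≤ m.length := List.length_pos_iff.2 hne
  have hpre : a <+: (List.replicate a.length m).flatten := by
    refine List.prefix_of_prefix_length_le (prefix_rep h a.length) (List.prefix_append _ _) ?_
    simp
    nlinarith
  have hmk := hm.rep a.length
  have hcomm := rep_comm m a.length
  generalize (List.replicate a.length m).flatten = M at *
  obtain ⟨t, rfl⟩ := hpre
  have hsp : m = m.take i ++ (m.get i :: m.drop (i + 1)) := by simp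
  generalize m.get i = e at *
  generalize m.take i = p at *
  generalize m.drop (i + 1) = s at *
  have hp : IsPathFrom G v p (G.src f) := by
    rw [hsp] at hm
    obtain ⟨y, h1, h2⟩ := hm.split
    cases h2 with
    | cons _ h3 _ => rw [hf, h3]; exact h1
  refine ⟨t ++ (p ++ [f]), G.rng f, ?_, ?_⟩
  · rw [← List.append_assoc]
    exact hmk.app (hp.app (IsPathFrom.cons f rfl (IsPathFrom.nil _)))
  · rw [← List.append_assoc a, ← List.append_assoc m, hcomm, List.append_assoc (a ++ t),
      List.prefix_append_right_inj, hsp, List.append_assoc, List.prefix_append_right_inj]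
    simp [hfi]

end Helpers

end LPAGraph

open LPAGraph in
/-- **Lemma.**  Suppose `E` satisfies Condition (L).  If `F` is a finite set of paths of
positive length and `v ∈ E⁰`, then there exists a path `α ∈ E*` with `s(α) = v` such that
`α* μ α = 0` in `L_R(E)` for every `μ ∈ F`. -/
theorem stmt6 (R : Type) [CommRing R] (G : LPAGraph) (hL : G.CondL)
    (F : Finset (G.V × List G.E))
    (hF : ∀ p ∈ F, p.2 ≠ [] ∧ ∃ w : G.V, IsPathFrom G p.1 p.2 w)
    (v : G.V) :
    ∃ (es : List G.E) (w : G.V), IsPathFrom G v es w ∧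
      ∀ p ∈ F,
        ghostPathElem R G v es * pathElem R G p.1 p.2 * pathElem R G v es = 0 := by
  classical
  induction F using Finset.induction_on with
  | empty => exact ⟨[], v, IsPathFrom.nil v, by simp⟩
  | insert p F hp ih =>
    obtain ⟨a, w, ha, hk⟩ := ih (fun q hq => hF q (Finset.mem_insert_of_mem hq))
    have hk' : ∀ q ∈ F, uGhostPath R G v a * uPath R G q.1 q.2 * uPath R G v a = 0 :=
      fun q hq => congrArg Subtype.val (hk q hq)
    obtain ⟨hne, w', hw'⟩ := hF p (Finset.mem_insert_self p F)
    suffices hs : ∃ (b : List G.E) (x : G.V), IsPathFrom G v (a ++ b) x ∧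
        uGhostPath R G v (a ++ b) * uPath R G p.1 p.2 * uPath R G v (a ++ b) = 0 by
      obtain ⟨b, x, hb, hz⟩ := hs
      refine ⟨a ++ b, x, hb, fun q hq => Subtype.ext ?_⟩
      rcases Finset.mem_insert.1 hq with rfl | hq
      · exact hz
      · exact kill_ext R G b (hk' q hq)
    by_cases hc : v = p.1 ∧ w' = v
    · obtain ⟨h1, h2⟩ := hc
      rw [← h1, h2] at hw'
      obtain ⟨b, x, hb, hn⟩ := exists_ext G hL ha hw' hne
      refine ⟨b, x, hb, ?_⟩
      rw [← h1]
      exact kill_closed R G hw' hne hn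
    · exact ⟨[], w, by simpa using ha, kill_open R G hw' hne hc⟩
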